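/- arXiv:2508.18656 — 8 statements merged into one kernel-verified Lean document; each statement's English description precedes it below -/
import Mathlib

section
/- For every separable real Banach space E there exists a linear isometry T : E → ℓ^∞ (i.e., ‖T(x)‖_∞ = ‖x‖ for all x ∈ E) such that the range of T intersects c only at the origin: T(E) ∩ c = {0}. -/
open Filter Topology

noncomputable section

/-- `ℓ^∞`: the Banach space of bounded real sequences with the sup norm. -/
abbrev Linfty : Type := lp (fun _ : ℕ => ℝ) ⊤

/-- `c`: the set of convergent sequences inside `ℓ^∞`. -/
def convSeq : Set Linfty := {f | ∃ l : ℝ, Tendsto (fun n => (f : ℕ → ℝ) n) atTop (𝓝 l)}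

/-- The linear map into `ℓ^∞` induced by a sequence of functionals of norm at most one. -/
def evalLinfty {E : Type*} [NormedAddCommGroup E] [NormedSpace ℝ E] (g : ℕ → E →L[ℝ] ℝ)
    (hg : ∀ n, ‖g n‖ ≤ 1) : E →L[ℝ] Linfty :=
  LinearMap.mkContinuous
    { toFun := fun x => ⟨fun n => g n x, memℓp_infty ⟨‖x‖, by
        rintro _ ⟨n, rfl⟩
        exact (g n).le_of_opNorm_le (hg n) x |>.trans_eq (one_mul _)⟩⟩
      map_add' := fun x y => by ext n; exact map_add (g n) x y
      map_smul' := fun r x => by ext n; exact map_smul (g n) r x } 1 fun x =>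
    lp.norm_le_of_forall_le (by positivity) fun n => (g n).le_of_opNorm_le (hg n) x

theorem evalLinfty_apply {E : Type*} [NormedAddCommGroup E] [NormedSpace ℝ E]
    (g : ℕ → E →L[ℝ] ℝ) (hg : ∀ n, ‖g n‖ ≤ 1) (x : E) (n : ℕ) :
    (evalLinfty g hg x : ℕ → ℝ) n = g n x := rfl

/-- If the functionals norm a dense sequence, the induced map is isometric. -/
theorem norm_evalLinfty {E : Type*} [NormedAddCommGroup E] [NormedSpace ℝ E]
    (g : ℕ → E →L[ℝ] ℝ) (hg : ∀ n, ‖g n‖ ≤ 1) {d : ℕ → E} (hd : DenseRange d)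
    (h : ∀ a, ∃ n, ‖g n (d a)‖ = ‖d a‖) (x : E) : ‖evalLinfty g hg x‖ = ‖x‖ := by
  apply le_antisymm
  · exact lp.norm_le_of_forall_le (norm_nonneg x) fun n =>
      (g n).le_of_opNorm_le (hg n) x |>.trans_eq (one_mul _)
  · refine hd.induction_on (p := fun x => ‖x‖ ≤ ‖evalLinfty g hg x‖) x
      (isClosed_le continuous_norm (evalLinfty g hg).continuous.norm) fun a => ?_
    obtain ⟨n, hn⟩ := h a
    rw [← hn, ← evalLinfty_apply g hg]
    exact lp.norm_apply_le_norm ENNReal.top_ne_zero _ n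

/-- A sequence `(-1) ^ b * t` converges only if `t = 0`. -/
theorem eq_zero_of_tendsto_neg_one_pow_mul {t l : ℝ}
    (h : Tendsto (fun b : ℕ => (-1 : ℝ) ^ b * t) atTop (𝓝 l)) : t = 0 := by
  have h₁ := h.comp (tendsto_add_atTop_nat 1)
  have h₂ : Tendsto (fun b : ℕ => -((-1 : ℝ) ^ b * t)) atTop (𝓝 l) :=
    h₁.congr fun b => by simp [pow_succ]
  have hl : l = 0 := by linarith [tendsto_nhds_unique h₂ h.neg]
  have h₃ := h.abs
  simp only [abs_mul, abs_pow, abs_neg, abs_one, one_pow, one_mul, hl, abs_zero] at h₃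
  exact abs_eq_zero.mp (tendsto_nhds_unique tendsto_const_nhds h₃)

/-- Every separable real Banach space embeds isometrically into `ℓ^∞` with range
meeting `c` only at `0`. -/
theorem stmt0 (E : Type*) [NormedAddCommGroup E] [NormedSpace ℝ E] [CompleteSpace E]
    [TopologicalSpace.SeparableSpace E] :
    ∃ T : E →ₗᵢ[ℝ] Linfty, Set.range T ∩ convSeq = {0} := by
  choose f hf hfd using fun a : ℕ => exists_dual_vector'' ℝ (TopologicalSpace.denseSeq E a)
  let g : ℕ → E →L[ℝ] ℝ := fun n => (-1 : ℝ) ^ n.unpair.2 • f n.unpair.1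
  have hg : ∀ n, ‖g n‖ ≤ 1 := fun n => by simpa [g, norm_smul] using hf n.unpair.1
  have hg_pair : ∀ a b x, g (Nat.pair a b) x = (-1 : ℝ) ^ b * f a x := fun a b x => by simp [g]
  have hd := TopologicalSpace.denseRange_denseSeq E
  let T : E →ₗᵢ[ℝ] Linfty := ⟨evalLinfty g hg, norm_evalLinfty g hg hd fun a =>
    ⟨Nat.pair a 0, by simp [hg_pair, hfd]⟩⟩
  refine ⟨T, Set.Subset.antisymm ?_ ?_⟩
  · rintro _ ⟨⟨x, rfl⟩, l, hl⟩
    have hfx : ∀ a, f a x = 0 := fun a => by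
      have hpair : Tendsto (fun b => Nat.pair a b) atTop atTop :=
        tendsto_atTop_mono (Nat.right_le_pair a) tendsto_id
      exact eq_zero_of_tendsto_neg_one_pow_mul
        ((hl.comp hpair).congr fun b => hg_pair a b x)
    rw [Set.mem_singleton_iff]
    ext n
    change g n x = 0
    simp [g, hfx]
  · rintro _ rfl
    exact ⟨⟨0, map_zero T⟩, 0, tendsto_const_nhds⟩
end
end

section
/- Every separable real Banach space E is isometrically isomorphic to a closed linear subspace Y of ℓ^∞ satisfying Y ∩ c = {0}. -/
open Filter Topology

noncomputable section

/-- A separable real normed space has a norming sequence of functionals in the dual unit ball. -/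
theorem exists_seq_dual_norming (E : Type*) [NormedAddCommGroup E] [NormedSpace ℝ E]
    [TopologicalSpace.SeparableSpace E] :
    ∃ f : ℕ → E →L[ℝ] ℝ, (∀ k, ‖f k‖ ≤ 1) ∧ ∀ x C, (∀ k, ‖f k x‖ ≤ C) → ‖x‖ ≤ C := by
  choose f hf hfx using fun k => exists_dual_vector'' ℝ (TopologicalSpace.denseSeq E k)
  refine ⟨f, hf, fun x C hC => le_of_forall_pos_le_add fun ε hε => ?_⟩
  obtain ⟨k, hk⟩ := (TopologicalSpace.denseRange_denseSeq E).exists_dist_lt x (half_pos hε)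
  set y := TopologicalSpace.denseSeq E k
  have hy : ‖y‖ = f k x - f k (x - y) := by
    rw [map_sub, sub_sub_cancel]
    exact (hfx k).symm
  have hxy : ‖f k (x - y)‖ ≤ ‖x - y‖ := (f k).le_of_opNorm_le_of_le (hf k) le_rfl |>.trans_eq
    (one_mul _)
  have hx : ‖x‖ ≤ ‖y‖ + ‖x - y‖ := norm_le_norm_add_norm_sub' x y
  rw [dist_eq_norm] at hk
  linarith [hC k, Real.le_norm_self (f k x), neg_le_of_abs_le hxy]

/-- The linear map into `ℓ^∞` given by a sequence of functionals in the dual unit ball. -/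
def toLinfty {E : Type*} [NormedAddCommGroup E] [NormedSpace ℝ E] (g : ℕ → E →L[ℝ] ℝ)
    (hg : ∀ n x, ‖g n x‖ ≤ ‖x‖) : E →ₗ[ℝ] Linfty where
  toFun x := ⟨fun n => g n x, memℓp_infty ⟨‖x‖, by rintro _ ⟨n, rfl⟩; exact hg n x⟩⟩
  map_add' x y := lp.ext (funext fun n => map_add (g n) x y)
  map_smul' c x := lp.ext (funext fun n => map_smul (g n) c x)

/-- The sequence of functionals in which every `f k` and every `-f k` occurs infinitely often. -/
def signedRepeat {E : Type*} [NormedAddCommGroup E] [NormedSpace ℝ E] (f : ℕ → E →L[ℝ] ℝ)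
    (n : ℕ) : E →L[ℝ] ℝ :=
  (-1 : ℝ) ^ n • f (n / 2).unpair.1

section signedRepeat

variable {E : Type*} [NormedAddCommGroup E] [NormedSpace ℝ E] (f : ℕ → E →L[ℝ] ℝ)

theorem norm_signedRepeat_apply (n : ℕ) (x : E) :
    ‖signedRepeat f n x‖ = ‖f (n / 2).unpair.1 x‖ := by
  simp [signedRepeat]

theorem signedRepeat_even (k m : ℕ) : signedRepeat f (2 * Nat.pair k m) = f k := by
  simp [signedRepeat]

theorem signedRepeat_odd (k m : ℕ) : signedRepeat f (2 * Nat.pair k m + 1) = -f k := by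
  have h : (2 * Nat.pair k m + 1) / 2 = Nat.pair k m := by omega
  ext x
  simp [signedRepeat, h, pow_succ]

theorem eq_zero_of_tendsto_signedRepeat {x : E} {l : ℝ}
    (h : Tendsto (fun n => signedRepeat f n x) atTop (𝓝 l)) (k : ℕ) : f k x = 0 := by
  have hle (m : ℕ) : m ≤ Nat.pair k m := Nat.right_le_pair k m
  have heven : Tendsto (fun m => 2 * Nat.pair k m) atTop atTop :=
    tendsto_atTop_mono (fun m => by have := hle m; simp only [id]; omega) tendsto_id
  have hodd : Tendsto (fun m => 2 * Nat.pair k m + 1) atTop atTop :=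
    tendsto_atTop_mono (fun m => by have := hle m; simp only [id]; omega) tendsto_id
  have h1 := h.comp heven
  have h2 := h.comp hodd
  simp only [Function.comp_def, signedRepeat_even, signedRepeat_odd, neg_apply,
    tendsto_const_nhds_iff] at h1 h2
  linarith

end signedRepeat

/-- Every separable real Banach space is isometrically isomorphic to a closed subspace
`Y` of `ℓ^∞` with `Y ∩ c = {0}`. -/
theorem stmt1 (E : Type*) [NormedAddCommGroup E] [NormedSpace ℝ E] [CompleteSpace E]
    [TopologicalSpace.SeparableSpace E] :
    ∃ Y : Submodule ℝ Linfty, IsClosed (Y : Set Linfty) ∧ Nonempty (E ≃ₗᵢ[ℝ] Y) ∧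
      (Y : Set Linfty) ∩ convSeq = {0} := by
  obtain ⟨f, hf, hnorming⟩ := exists_seq_dual_norming E
  have hg (n : ℕ) (x : E) : ‖signedRepeat f n x‖ ≤ ‖x‖ := by
    rw [norm_signedRepeat_apply]
    simpa using (f (n / 2).unpair.1).le_of_opNorm_le (hf _) x
  let T : E →ₗᵢ[ℝ] Linfty :=
    { toLinearMap := toLinfty (signedRepeat f) hg
      norm_map' := fun x => le_antisymm
        (lp.norm_le_of_forall_le (norm_nonneg x) fun n => hg n x)
        (hnorming x _ fun k => by
          rw [← signedRepeat_even f k 0]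
          exact lp.norm_apply_le_norm ENNReal.top_ne_zero (toLinfty (signedRepeat f) hg x) _) }
  refine ⟨T.toLinearMap.range, ?_, ⟨T.equivRange⟩, ?_⟩
  · rw [LinearMap.coe_range]
    exact T.isometry.isClosedEmbedding.isClosed_range
  · refine Set.eq_singleton_iff_unique_mem.mpr
      ⟨⟨Submodule.zero_mem _, 0, tendsto_const_nhds⟩, ?_⟩
    rintro _ ⟨⟨x, rfl⟩, l, hl⟩
    have hx : x = 0 := norm_le_zero_iff.mp <| hnorming x 0 fun k => by
      rw [eq_zero_of_tendsto_signedRepeat f hl k, norm_zero]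
    rw [hx, map_zero]
end
end

section
/- Let D be a finite-dimensional linear subspace of ℓ^∞ with D ∩ c = {0}, and let E be a separable real Banach space. Then there exists a linear isometry T : E → ℓ^∞ such that T(E) ∩ (D + c) = {0}, where D + c = {d + y : d ∈ D, y ∈ c}. -/
open Filter Topology

noncomputable section

/-- A separable normed space admits a countable norming family of functionals in the dual ball. -/
theorem exists_seq_norming (E : Type*) [NormedAddCommGroup E] [NormedSpace ℝ E]
    [TopologicalSpace.SeparableSpace E] :
    ∃ f : ℕ → StrongDual ℝ E, (∀ k, ‖f k‖ ≤ 1) ∧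
      ∀ x : E, ∀ C : ℝ, (∀ k, |f k x| ≤ C) → ‖x‖ ≤ C := by
  choose g hg hgx using fun x : E => exists_dual_vector'' ℝ x
  refine ⟨fun k => g (TopologicalSpace.denseSeq E k), fun k => hg _, fun x C hC => ?_⟩
  refine le_of_forall_pos_le_add fun ε hε => ?_
  obtain ⟨k, hk⟩ := (TopologicalSpace.denseRange_denseSeq E).exists_dist_lt x (half_pos hε)
  set u := TopologicalSpace.denseSeq E k
  have hgu : g u u = ‖u‖ := by simpa using hgx u
  have hle : ‖g u (x - u)‖ ≤ ‖x - u‖ := by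
    simpa using (g u).le_of_opNorm_le (hg u) (x - u)
  have hC' := (abs_le.1 (hC k)).2
  have hsub : g u (x - u) = g u x - ‖u‖ := by rw [map_sub, hgu]
  have habs := (abs_le.1 (Real.norm_eq_abs _ ▸ hle)).1
  have htri : ‖x‖ ≤ ‖u‖ + ‖x - u‖ := norm_le_norm_add_norm_sub' x u
  rw [dist_eq_norm] at hk
  change g u x ≤ C at hC'
  linarith

/-- Along a suitable subsequence, all members of a finite-dimensional subspace of `ℓ^∞` converge. -/
theorem exists_subseq_tendsto (D : Submodule ℝ Linfty) [FiniteDimensional ℝ D] :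
    ∃ φ : ℕ → ℕ, StrictMono φ ∧
      ∀ d ∈ D, ∃ l : ℝ, Tendsto (fun n => (d : ℕ → ℝ) (φ n)) atTop (𝓝 l) := by
  let ev : ℕ → StrongDual ℝ D := fun n =>
    LinearMap.mkContinuous
      { toFun := fun d => ((d : Linfty) : ℕ → ℝ) n
        map_add' := fun _ _ => rfl
        map_smul' := fun _ _ => rfl } 1
      fun d => by
        rw [one_mul]
        exact lp.norm_apply_le_norm ENNReal.top_ne_zero (d : Linfty) n
  have hev : ∀ n, ev n ∈ Metric.closedBall (0 : StrongDual ℝ D) 1 := fun n =>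
    (mem_closedBall_zero_iff (E := StrongDual ℝ D)).2 (LinearMap.mkContinuous_norm_le _ zero_le_one _)
  have : ProperSpace (StrongDual ℝ D) := FiniteDimensional.proper ℝ (StrongDual ℝ D)
  obtain ⟨a, -, φ, hφ, ha⟩ := tendsto_subseq_of_bounded Metric.isBounded_closedBall hev
  exact ⟨φ, hφ, fun d hd => ⟨a ⟨d, hd⟩,
    ((ContinuousLinearMap.apply ℝ ℝ (⟨d, hd⟩ : D)).continuous.tendsto a).comp ha⟩⟩

/-- A sequence of functionals in the dual ball induces an operator into `ℓ^∞` whose coordinates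
are placed along an injective sequence of indices, the remaining coordinates being zero. -/
theorem exists_linearMap_extend {E : Type*} [NormedAddCommGroup E] [NormedSpace ℝ E]
    {φ : ℕ → ℕ} (hφ : Function.Injective φ) (h : ℕ → StrongDual ℝ E) (hh : ∀ j, ‖h j‖ ≤ 1) :
    ∃ T : E →ₗ[ℝ] Linfty, (∀ x j, (T x : ℕ → ℝ) (φ j) = h j x) ∧ ∀ x, ‖T x‖ ≤ ‖x‖ := by
  let F : E → ℕ → ℝ := fun x => Function.extend φ (fun j => h j x) 0
  have hFφ : ∀ x j, F x (φ j) = h j x := fun x j => hφ.extend_apply _ _ j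
  have hF0 : ∀ x n, (¬∃ j, φ j = n) → F x n = 0 := fun x n hn =>
    Function.extend_apply' _ _ n hn
  have hF : ∀ x n, ‖F x n‖ ≤ ‖x‖ := by
    intro x n
    by_cases hn : ∃ j, φ j = n
    · obtain ⟨j, rfl⟩ := hn
      rw [hFφ]
      simpa using (h j).le_of_opNorm_le (hh j) x
    · simp [hF0 x n hn]
  refine ⟨{ toFun := fun x => ⟨F x, memℓp_infty ⟨‖x‖, ?_⟩⟩, map_add' := ?_, map_smul' := ?_ },
    hFφ, fun x => lp.norm_le_of_forall_le (norm_nonneg x) (hF x)⟩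
  · rintro _ ⟨n, rfl⟩
    exact hF x n
  · intro x y
    ext n
    change F (x + y) n = F x n + F y n
    by_cases hn : ∃ j, φ j = n
    · obtain ⟨j, rfl⟩ := hn
      simp [hFφ]
    · simp [hF0 _ n hn]
  · intro r x
    ext n
    change F (r • x) n = r * F x n
    by_cases hn : ∃ j, φ j = n
    · obtain ⟨j, rfl⟩ := hn
      simp [hFφ]
    · simp [hF0 _ n hn]

/-- Given finite-dimensional `D ⊆ ℓ^∞` with `D ∩ c = {0}` and a separable Banach space
`E`, there is a linear isometry `T : E → ℓ^∞` with `T(E) ∩ (D + c) = {0}`. -/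
theorem stmt3 (D : Submodule ℝ Linfty) (hDfin : FiniteDimensional ℝ D)
    (hDc : (D : Set Linfty) ∩ convSeq = {0})
    (E : Type*) [NormedAddCommGroup E] [NormedSpace ℝ E] [CompleteSpace E]
    [TopologicalSpace.SeparableSpace E] :
    ∃ T : E →ₗᵢ[ℝ] Linfty,
      Set.range T ∩ {z : Linfty | ∃ d ∈ D, ∃ y ∈ convSeq, z = d + y} = {0} := by
  obtain ⟨f, hf, hnorming⟩ := exists_seq_norming E
  obtain ⟨φ, hφ, hD⟩ := exists_subseq_tendsto D
  let h : ℕ → StrongDual ℝ E := fun j => (-1 : ℝ) ^ j.unpair.1 • f j.unpair.2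
  have hh : ∀ j, ‖h j‖ ≤ 1 := fun j => by simpa [h, norm_smul] using hf _
  have hpair : ∀ a b x, h (Nat.pair a b) x = (-1 : ℝ) ^ a * f b x := fun a b x => by simp [h]
  obtain ⟨T, hTφ, hT⟩ := exists_linearMap_extend hφ.injective h hh
  have hTnorm : ∀ x, ‖T x‖ = ‖x‖ := fun x => (hT x).antisymm <| hnorming x _ fun k => by
    have := lp.norm_apply_le_norm ENNReal.top_ne_zero (T x) (φ (Nat.pair 0 k))
    rwa [hTφ, hpair, pow_zero, one_mul] at this
  refine ⟨⟨T, hTnorm⟩, Set.Subset.antisymm ?_ ?_⟩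
  · rintro _ ⟨⟨x, rfl⟩, d, hd, y, ⟨l, hl⟩, hxy⟩
    change T x = d + y at hxy
    obtain ⟨l', hl'⟩ := hD d hd
    have hlim : Tendsto (fun j => h j x) atTop (𝓝 (l' + l)) := by
      refine (hl'.add (hl.comp hφ.tendsto_atTop)).congr fun j => ?_
      rw [← hTφ, hxy]
      rfl
    have hzero : ∀ b, f b x = 0 := by
      intro b
      have htop : ∀ r, Tendsto (fun m => Nat.pair (2 * m + r) b) atTop atTop := fun r =>
        tendsto_atTop_mono (fun m => le_trans (by dsimp only [id]; lia) (Nat.left_le_pair (2 * m + r) b)) tendsto_id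
      have heven := hlim.comp (htop 0)
      have hodd := hlim.comp (htop 1)
      simp only [Function.comp_def, hpair, pow_add, pow_mul, even_two.neg_one_pow, one_pow,
        pow_zero, pow_one, one_mul, neg_one_mul] at heven hodd
      have h₁ := tendsto_nhds_unique tendsto_const_nhds heven
      have h₂ := tendsto_nhds_unique tendsto_const_nhds hodd
      linarith
    have hx : x = 0 := norm_le_zero_iff.1 (hnorming x 0 fun k => by simp [hzero k])
    simp [hx]
  · rintro _ rfl
    exact ⟨⟨0, map_zero _⟩, 0, D.zero_mem, 0, ⟨0, tendsto_const_nhds⟩, (add_zero 0).symm⟩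
end
end

section
/- Let D be a linear subspace of ℓ^∞ admitting a countable Hamel (algebraic) basis and satisfying D ∩ c = {0}, and let E be a separable real Banach space. Then there exists a linear isometry T : E → ℓ^∞ such that T(E) ∩ (D + c) = {0}. -/
open Filter Topology

noncomputable section

/-- A separable normed space has a norming sequence of functionals in the dual unit ball. -/
theorem exists_norming_seq (E : Type*) [NormedAddCommGroup E] [NormedSpace ℝ E]
    [TopologicalSpace.SeparableSpace E] :
    ∃ f : ℕ → StrongDual ℝ E, (∀ i, ‖f i‖ ≤ 1) ∧
      ∀ x C, (∀ i, |f i x| ≤ C) → ‖x‖ ≤ C := by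
  choose f hf hfx using fun i => exists_dual_vector'' ℝ (TopologicalSpace.denseSeq E i)
  refine ⟨f, hf, fun x C hC => le_of_forall_pos_le_add fun ε hε => ?_⟩
  obtain ⟨i, hi⟩ := (TopologicalSpace.denseRange_denseSeq E).exists_dist_lt x (half_pos hε)
  set u := TopologicalSpace.denseSeq E i
  rw [dist_eq_norm] at hi
  have hu : f i u = ‖u‖ := hfx i
  have h₁ : ‖x‖ ≤ ‖x - u‖ + ‖u‖ := norm_le_norm_sub_add x u
  have h₂ : |f i (x - u)| ≤ ‖x - u‖ := by
    simpa using (f i).le_of_opNorm_le (hf i) (x - u)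
  rw [map_sub] at h₂
  linarith [neg_abs_le (f i x - f i u), le_abs_self (f i x), hC i]

/-- A norming sequence of functionals in the dual unit ball gives the coordinates of a linear
isometry into `ℓ^∞`. -/
theorem exists_linearIsometry_of_norming {E : Type*} [NormedAddCommGroup E] [NormedSpace ℝ E]
    (g : ℕ → StrongDual ℝ E) (hg : ∀ n, ‖g n‖ ≤ 1)
    (hnorming : ∀ x C, (∀ n, |g n x| ≤ C) → ‖x‖ ≤ C) :
    ∃ T : E →ₗᵢ[ℝ] Linfty, ∀ x n, T x n = g n x := by
  have hle : ∀ x n, ‖g n x‖ ≤ ‖x‖ := fun x n => by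
    simpa using (g n).le_of_opNorm_le (hg n) x
  let T : E →ₗ[ℝ] Linfty :=
    { toFun := fun x => ⟨fun n => g n x, memℓp_infty ⟨‖x‖, by rintro _ ⟨n, rfl⟩; exact hle x n⟩⟩
      map_add' := fun x y => by ext n; exact map_add (g n) x y
      map_smul' := fun a x => by ext n; exact map_smul (g n) a x }
  refine ⟨⟨T, fun x => le_antisymm ?_ ?_⟩, fun x n => rfl⟩
  · exact lp.norm_le_of_forall_le (norm_nonneg x) (hle x)
  · exact hnorming x _ fun n => lp.norm_apply_le_norm ENNReal.top_ne_zero (T x) n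

/-- Countably many bounded sequences converge along a common subsequence. -/
theorem exists_strictMono_forall_tendsto {B : Set Linfty} (hB : B.Countable) :
    ∃ φ : ℕ → ℕ, StrictMono φ ∧
      ∀ b ∈ B, ∃ l : ℝ, Tendsto (fun k => (b : ℕ → ℝ) (φ k)) atTop (𝓝 l) := by
  have := hB.to_subtype
  have hK : IsCompact (Set.univ.pi fun b : B => Metric.closedBall (0 : ℝ) ‖(b : Linfty)‖) :=
    isCompact_univ_pi fun b => isCompact_closedBall _ _
  obtain ⟨l, -, φ, hφ, hl⟩ := hK.tendsto_subseq (x := fun n (b : B) => (b : Linfty) n)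
    fun n b _ => by
      simpa using lp.norm_apply_le_norm ENNReal.top_ne_zero (b : Linfty) n
  exact ⟨φ, hφ, fun b hb => ⟨l ⟨b, hb⟩, tendsto_pi_nhds.1 hl ⟨b, hb⟩⟩⟩

/-- The sequences converging along `φ` are closed under linear combinations. -/
theorem exists_tendsto_comp_of_mem_span {B : Set Linfty} {φ : ℕ → ℕ}
    (hB : ∀ b ∈ B, ∃ l : ℝ, Tendsto (fun k => (b : ℕ → ℝ) (φ k)) atTop (𝓝 l))
    {d : Linfty} (hd : d ∈ Submodule.span ℝ B) :
    ∃ l : ℝ, Tendsto (fun k => (d : ℕ → ℝ) (φ k)) atTop (𝓝 l) := by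
  induction hd using Submodule.span_induction with
  | mem b hb => exact hB b hb
  | zero => exact ⟨0, tendsto_const_nhds⟩
  | add x y _ _ hx hy =>
    obtain ⟨l, hl⟩ := hx
    obtain ⟨m, hm⟩ := hy
    exact ⟨l + m, hl.add hm⟩
  | smul a x _ hx =>
    obtain ⟨l, hl⟩ := hx
    exact ⟨a * l, hl.const_mul a⟩

/-- The sequence listing each `f i` and each `-f i` infinitely often. -/
def alternatingRepeat {F : Type*} [Neg F] (f : ℕ → F) (k : ℕ) : F :=
  if Even k.unpair.2 then f k.unpair.1 else -f k.unpair.1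

theorem alternatingRepeat_pair_even {F : Type*} [Neg F] (f : ℕ → F) (i m : ℕ) :
    alternatingRepeat f (Nat.pair i (2 * m)) = f i := by
  simp [alternatingRepeat]

theorem alternatingRepeat_pair_odd {F : Type*} [Neg F] (f : ℕ → F) (i m : ℕ) :
    alternatingRepeat f (Nat.pair i (2 * m + 1)) = -f i := by
  simp [alternatingRepeat]

theorem eq_zero_of_tendsto_alternatingRepeat {E : Type*} [NormedAddCommGroup E] [NormedSpace ℝ E]
    {f : ℕ → StrongDual ℝ E} {x : E} {l : ℝ}
    (h : Tendsto (fun k => alternatingRepeat f k x) atTop (𝓝 l)) (i : ℕ) : f i x = 0 := by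
  have hpair : StrictMono (Nat.pair i) := fun _ _ hab => Nat.pair_lt_pair_right i hab
  have heven : StrictMono fun m => Nat.pair i (2 * m) :=
    hpair.comp fun a b (hab : a < b) => (by omega : 2 * a < 2 * b)
  have hodd : StrictMono fun m => Nat.pair i (2 * m + 1) :=
    hpair.comp fun a b (hab : a < b) => (by omega : 2 * a + 1 < 2 * b + 1)
  have h₁ := h.comp heven.tendsto_atTop
  have h₂ := h.comp hodd.tendsto_atTop
  simp only [Function.comp_def, alternatingRepeat_pair_even] at h₁
  simp only [Function.comp_def, alternatingRepeat_pair_odd, neg_apply] at h₂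
  have e₁ := tendsto_nhds_unique h₁ tendsto_const_nhds
  have e₂ := tendsto_nhds_unique h₂ tendsto_const_nhds
  linarith

/-- Given `D ⊆ ℓ^∞` with a countable Hamel basis and `D ∩ c = {0}`, and a separable
Banach space `E`, there is a linear isometry `T : E → ℓ^∞` with `T(E) ∩ (D + c) = {0}`. -/
theorem stmt4 (D : Submodule ℝ Linfty)
    (hDbasis : ∃ B : Set Linfty, B.Countable ∧
      LinearIndependent ℝ ((↑) : B → Linfty) ∧ Submodule.span ℝ B = D)
    (hDc : (D : Set Linfty) ∩ convSeq = {0})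
    (E : Type*) [NormedAddCommGroup E] [NormedSpace ℝ E] [CompleteSpace E]
    [TopologicalSpace.SeparableSpace E] :
    ∃ T : E →ₗᵢ[ℝ] Linfty,
      Set.range T ∩ {z : Linfty | ∃ d ∈ D, ∃ y ∈ convSeq, z = d + y} = {0} := by
  obtain ⟨B, hB, -, rfl⟩ := hDbasis
  obtain ⟨φ, hφ, hφB⟩ := exists_strictMono_forall_tendsto hB
  obtain ⟨f, hf, hnorming⟩ := exists_norming_seq E
  let g : ℕ → StrongDual ℝ E := Function.extend φ (alternatingRepeat f) 0
  have hgφ : ∀ k, g (φ k) = alternatingRepeat f k := hφ.injective.extend_apply _ _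
  have hg : ∀ n, ‖g n‖ ≤ 1 := fun n => by
    by_cases hn : ∃ k, φ k = n
    · obtain ⟨k, rfl⟩ := hn
      rw [hgφ, alternatingRepeat]
      split_ifs <;> simp [hf]
    · simp [g, Function.extend_apply' _ _ _ hn]
  obtain ⟨T, hT⟩ := exists_linearIsometry_of_norming g hg fun x C hC =>
    hnorming x C fun i => by
      simpa [hgφ, alternatingRepeat] using hC (φ (Nat.pair i 0))
  refine ⟨T, Set.eq_singleton_iff_unique_mem.2 ⟨⟨⟨0, map_zero T⟩, 0, zero_mem _, 0,
    ⟨0, tendsto_const_nhds⟩, (add_zero 0).symm⟩, ?_⟩⟩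
  rintro _ ⟨⟨x, rfl⟩, d, hd, y, ⟨m, hm⟩, hx⟩
  obtain ⟨l, hl⟩ := exists_tendsto_comp_of_mem_span hφB hd
  have hlim : Tendsto (fun k => alternatingRepeat f k x) atTop (𝓝 (l + m)) := by
    refine (hl.add (hm.comp hφ.tendsto_atTop)).congr fun k => ?_
    rw [← hgφ, ← hT, hx]
    rfl
  have hx0 : x = 0 := norm_le_zero_iff.1 <| hnorming x 0 fun i => by
    rw [eq_zero_of_tendsto_alternatingRepeat hlim i, abs_zero]
  rw [hx0, map_zero]
end
end

section
/- Let D be a linear subspace of ℓ^∞ admitting a countable Hamel (algebraic) basis and satisfying D ∩ c = {0}, and let E be a separable real Banach space. Then there exists a linear subspace Z of ℓ^∞ such that D ⊆ Z, Z contains a linear subspace isometrically isomorphic to E, and Z ∩ c = {0}. -/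
open Filter Topology

noncomputable section

/-- The code of the initial segment of length `n` of a binary sequence. -/
def segmentCode (a : ℕ → Bool) (n : ℕ) : ℕ := Encodable.encode ((List.range n).map a)

lemma segmentCode_eq {a b : ℕ → Bool} {n m : ℕ} (h : segmentCode a n = segmentCode b m) :
    n = m ∧ ∀ i < n, a i = b i := by
  have h' := Encodable.encode_injective h
  have hnm : n = m := by simpa using congrArg List.length h'
  subst hnm
  refine ⟨rfl, fun i hi => ?_⟩
  exact List.map_inj_left.1 h' i (List.mem_range.2 hi)

lemma segmentCode_injective (a : ℕ → Bool) : Function.Injective (segmentCode a) :=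
  fun _ _ h => (segmentCode_eq h).1

/-- The ranges of `segmentCode a` form an almost disjoint family. -/
lemma finite_range_segmentCode_inter {a b : ℕ → Bool} (hab : a ≠ b) :
    (Set.range (segmentCode a) ∩ Set.range (segmentCode b)).Finite := by
  obtain ⟨i, hi⟩ := Function.ne_iff.1 hab
  refine ((Set.finite_Iic i).image (segmentCode a)).subset ?_
  rintro _ ⟨⟨n, rfl⟩, ⟨m, hm⟩⟩
  refine ⟨n, ?_, rfl⟩
  by_contra hn
  exact hi ((segmentCode_eq hm.symm).2 i (not_le.1 hn))

lemma infinite_compl_biUnion_segmentCode (s : Finset (ℕ → Bool)) :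
    (⋃ a ∈ s, Set.range (segmentCode a))ᶜ.Infinite := by
  obtain ⟨b, hb⟩ := Infinite.exists_notMem_finset s
  have hfin : (Set.range (segmentCode b) ∩ ⋃ a ∈ s, Set.range (segmentCode a)).Finite := by
    rw [Set.inter_iUnion₂]
    refine s.finite_toSet.biUnion fun a ha => finite_range_segmentCode_inter ?_
    rintro rfl
    exact hb ha
  refine ((Set.infinite_range_of_injective (segmentCode_injective b)).sdiff hfin).mono ?_
  rintro x ⟨hx, hx'⟩ hx''
  exact hx' ⟨hx, hx''⟩

lemma atTop_inf_principal_neBot {A : Set ℕ} (hA : A.Infinite) : (atTop ⊓ 𝓟 A).NeBot := by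
  rw [← frequently_mem_iff_neBot]
  exact Nat.frequently_atTop_iff_infinite.2 hA

lemma tendsto_atTop_of_union {u : ℕ → ℝ} {A B : Set ℕ} {a b : ℝ}
    (ha : Tendsto u (atTop ⊓ 𝓟 A) (𝓝 a)) (hb : Tendsto u (atTop ⊓ 𝓟 B) (𝓝 b))
    (hinter : (A ∩ B).Infinite) (hunion : (A ∪ B)ᶜ.Finite) : Tendsto u atTop (𝓝 a) := by
  have hne := atTop_inf_principal_neBot hinter
  have hab : a = b := tendsto_nhds_unique
    (ha.mono_left (inf_le_inf_left _ (principal_mono.2 Set.inter_subset_left)))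
    (hb.mono_left (inf_le_inf_left _ (principal_mono.2 Set.inter_subset_right)))
  subst hab
  have hmem : A ∪ B ∈ (atTop : Filter ℕ) := by
    rw [← Nat.cofinite_eq_atTop]
    exact hunion
  have := ha.sup hb
  rwa [← inf_sup_left, sup_principal, inf_eq_left.2 (le_principal_iff.2 hmem)] at this

/-- Nonconvergent sequences, each convergent off a different member of the almost disjoint family,
are linearly independent. -/
lemma linearIndependent_of_tendsto_compl {D : Submodule ℝ Linfty}
    (hDc : (D : Set Linfty) ∩ convSeq = {0}) (v : (ℕ → Bool) → D) (l : (ℕ → Bool) → ℝ)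
    (hv : ∀ a, v a ≠ 0)
    (hl : ∀ a, Tendsto ((v a : Linfty) : ℕ → ℝ) (atTop ⊓ 𝓟 (Set.range (segmentCode a))ᶜ)
      (𝓝 (l a))) :
    LinearIndependent ℝ v := by
  classical
  rw [linearIndependent_iff']
  intro s g hsum a ha
  by_contra hga
  have hlim : Tendsto ((v a : Linfty) : ℕ → ℝ)
      (atTop ⊓ 𝓟 (⋃ b ∈ s.erase a, Set.range (segmentCode b))ᶜ)
      (𝓝 (-(g a)⁻¹ * ∑ b ∈ s.erase a, g b * l b)) := by
    have hva : ((v a : Linfty) : ℕ → ℝ) =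
        fun n => -(g a)⁻¹ * ∑ b ∈ s.erase a, g b * ((v b : Linfty) : ℕ → ℝ) n := by
      funext n
      have h0 : ∑ b ∈ s, g b * ((v b : Linfty) : ℕ → ℝ) n = 0 := by
        have h1 : ∑ b ∈ s, g b • (v b : Linfty) = 0 := by
          simpa using congrArg (D.subtype) hsum
        have h2 := congrFun (congrArg (fun x : Linfty => (x : ℕ → ℝ)) h1) n
        simp only [lp.coeFn_sum] at h2
        exact (Finset.sum_apply n s fun b => g b • ((v b : Linfty) : ℕ → ℝ)).symm.trans h2
      rw [← Finset.add_sum_erase s _ ha] at h0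
      rw [eq_neg_of_add_eq_zero_right h0]
      field_simp
    rw [hva]
    refine (tendsto_finsetSum _ fun b hb => ((hl b).mono_left ?_).const_mul _).const_mul _
    refine inf_le_inf_left _ (principal_mono.2 (Set.compl_subset_compl.2 ?_))
    exact Set.subset_biUnion_of_mem (u := fun b => Set.range (segmentCode b)) hb
  have hconv : Tendsto ((v a : Linfty) : ℕ → ℝ) atTop (𝓝 (l a)) := by
    refine tendsto_atTop_of_union (hl a) hlim ?_ ?_
    · rw [← Set.compl_union]
      convert infinite_compl_biUnion_segmentCode s using 2
      conv_rhs => rw [← Finset.insert_erase ha]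
      rw [Finset.set_biUnion_insert]
    · rw [← Set.compl_inter, compl_compl, Set.inter_iUnion₂]
      exact (s.erase a).finite_toSet.biUnion fun b hb =>
        finite_range_segmentCode_inter (Finset.ne_of_mem_erase hb).symm
  have hmem : (v a : Linfty) ∈ (D : Set Linfty) ∩ convSeq := ⟨(v a).2, l a, hconv⟩
  rw [hDc] at hmem
  exact hv a (Subtype.ext hmem)

/-- A subspace of countable dimension meeting `c` trivially still has no nonzero convergent member
after restricting to the complement of a suitable infinite set. -/
lemma exists_injective_forall_tendsto_compl_range {D : Submodule ℝ Linfty} {B : Set Linfty}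
    (hB : B.Countable) (hspan : Submodule.span ℝ B = D)
    (hDc : (D : Set Linfty) ∩ convSeq = {0}) :
    ∃ f : ℕ → ℕ, Function.Injective f ∧ (Set.range f)ᶜ.Infinite ∧
      ∀ d ∈ D, ∀ l : ℝ, Tendsto (d : ℕ → ℝ) (atTop ⊓ 𝓟 (Set.range f)ᶜ) (𝓝 l) → d = 0 := by
  suffices h : ∃ a, ∀ d ∈ D, ∀ l : ℝ,
      Tendsto (d : ℕ → ℝ) (atTop ⊓ 𝓟 (Set.range (segmentCode a))ᶜ) (𝓝 l) → d = 0 by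
    obtain ⟨a, ha⟩ := h
    exact ⟨segmentCode a, segmentCode_injective a,
      by simpa using infinite_compl_biUnion_segmentCode {a}, ha⟩
  by_contra! h
  choose d hd l hl hne using h
  have hind := linearIndependent_of_tendsto_compl hDc (fun a => ⟨d a, hd a⟩) l
    (fun a h0 => hne a (congrArg Subtype.val h0)) hl
  have hrank : Cardinal.mk (ℕ → Bool) ≤ Cardinal.aleph0 := by
    refine hind.cardinal_le_rank.trans ?_
    rw [← hspan]
    exact (rank_span_le B).trans hB.le_aleph0
  rw [← Cardinal.power_def, Cardinal.mk_bool, Cardinal.mk_nat] at hrank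
  exact (Cardinal.cantor _).not_ge hrank

lemma exists_norming_sequence (E : Type*) [NormedAddCommGroup E] [NormedSpace ℝ E]
    [TopologicalSpace.SeparableSpace E] :
    ∃ g : ℕ → StrongDual ℝ E, (∀ k, ‖g k‖ ≤ 1) ∧
      ∀ e : E, ∀ C : ℝ, (∀ k, |g k e| ≤ C) → ‖e‖ ≤ C := by
  choose g hg hgx using fun k => exists_dual_vector'' ℝ (TopologicalSpace.denseSeq E k)
  refine ⟨g, hg, fun e C hC => le_of_forall_pos_le_add fun ε hε => ?_⟩
  obtain ⟨k, hk⟩ := (TopologicalSpace.denseRange_denseSeq E).exists_dist_lt e (half_pos hε)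
  rw [dist_eq_norm] at hk
  set x := TopologicalSpace.denseSeq E k
  have h1 : ‖e‖ ≤ ‖x‖ + ‖e - x‖ := by simpa using norm_add_le x (e - x)
  have h2 : g k x = ‖x‖ := hgx k
  have h3 : |g k (e - x)| ≤ ‖e - x‖ := (g k).le_of_opNorm_le_of_le (hg k) le_rfl |>.trans (by simp)
  have h4 : g k e = g k x + g k (e - x) := by simp
  linarith [hC k, le_abs_self (g k e), neg_abs_le (g k (e - x))]

lemma exists_linearIsometry_repeating (E : Type*) [NormedAddCommGroup E] [NormedSpace ℝ E]
    [TopologicalSpace.SeparableSpace E] {f : ℕ → ℕ} (hf : Function.Injective f) :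
    ∃ T : E →ₗᵢ[ℝ] Linfty, (∀ e, ∀ n ∉ Set.range f, (T e : ℕ → ℝ) n = 0) ∧
      ∀ e k j, (T e : ℕ → ℝ) (f (Nat.pair k j)) = (T e : ℕ → ℝ) (f (Nat.pair k 0)) := by
  obtain ⟨g, hg, hnorm⟩ := exists_norming_sequence E
  let t : E → ℕ → ℝ := fun e => Function.extend f (fun n => g n.unpair.1 e) 0
  have ht : ∀ e n, t e (f n) = g n.unpair.1 e := fun e n => hf.extend_apply _ _ n
  have ht0 : ∀ e, ∀ n ∉ Set.range f, t e n = 0 := fun e n hn =>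
    Function.extend_apply' _ _ _ hn
  have hbound : ∀ e n, ‖t e n‖ ≤ ‖e‖ := by
    intro e n
    by_cases hn : n ∈ Set.range f
    · obtain ⟨m, rfl⟩ := hn
      rw [ht]
      exact (ContinuousLinearMap.le_of_opNorm_le _ (hg _) e).trans (by simp)
    · simp [ht0 e n hn]
  have hmem : ∀ e, Memℓp (t e) ⊤ := fun e =>
    memℓp_infty ⟨‖e‖, by rintro _ ⟨n, rfl⟩; exact hbound e n⟩
  let T : E →ₗ[ℝ] Linfty :=
    { toFun := fun e => ⟨t e, hmem e⟩
      map_add' := fun x y => by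
        ext n
        change t (x + y) n = t x n + t y n
        by_cases hn : n ∈ Set.range f
        · obtain ⟨m, rfl⟩ := hn
          simp [ht]
        · simp [ht0 _ n hn]
      map_smul' := fun r x => by
        ext n
        change t (r • x) n = r * t x n
        by_cases hn : n ∈ Set.range f
        · obtain ⟨m, rfl⟩ := hn
          simp [ht]
        · simp [ht0 _ n hn] }
  refine ⟨⟨T, fun e => le_antisymm ?_ ?_⟩, ht0, fun e k j => ?_⟩
  · exact lp.norm_le_of_forall_le (norm_nonneg e) (hbound e)
  · refine hnorm e _ fun k => ?_
    have h := lp.norm_apply_le_norm ENNReal.top_ne_zero (T e) (f (Nat.pair k 0))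
    change ‖t e (f (Nat.pair k 0))‖ ≤ _ at h
    simpa [ht] using h
  · change t e _ = t e _
    simp [ht]

/-- Given `D ⊆ ℓ^∞` with a countable Hamel basis and `D ∩ c = {0}`, and a separable
Banach space `E`, there is a subspace `Z` with `D ⊆ Z`, containing an isometric copy
of `E`, and `Z ∩ c = {0}`. -/
theorem stmt5 (D : Submodule ℝ Linfty)
    (hDbasis : ∃ B : Set Linfty, B.Countable ∧
      LinearIndependent ℝ ((↑) : B → Linfty) ∧ Submodule.span ℝ B = D)
    (hDc : (D : Set Linfty) ∩ convSeq = {0})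
    (E : Type*) [NormedAddCommGroup E] [NormedSpace ℝ E] [CompleteSpace E]
    [TopologicalSpace.SeparableSpace E] :
    ∃ Z : Submodule ℝ Linfty, D ≤ Z ∧
      (∃ F : Submodule ℝ Linfty, F ≤ Z ∧ Nonempty (E ≃ₗᵢ[ℝ] F)) ∧
      (Z : Set Linfty) ∩ convSeq = {0} := by
  obtain ⟨B, hB, -, hspan⟩ := hDbasis
  obtain ⟨f, hf, hinf, hD⟩ := exists_injective_forall_tendsto_compl_range hB hspan hDc
  obtain ⟨T, hT0, hT⟩ := exists_linearIsometry_repeating E hf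
  refine ⟨D ⊔ LinearMap.range T.toLinearMap, le_sup_left,
    ⟨LinearMap.range T.toLinearMap, le_sup_right, ⟨T.equivRange⟩⟩, ?_⟩
  refine Set.Subset.antisymm ?_ ?_
  · rintro z ⟨hz, l, hl⟩
    obtain ⟨d, hd, _, ⟨e, rfl⟩, rfl⟩ := Submodule.mem_sup.1 hz
    have hd0 : d = 0 := by
      refine hD d hd l ((hl.mono_left inf_le_left).congr' ?_)
      filter_upwards [mem_inf_of_right (mem_principal_self _)] with n hn
      simp [hT0 e n hn]
    subst hd0
    rw [zero_add] at hl ⊢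
    change Tendsto (T e : ℕ → ℝ) atTop (𝓝 l) at hl
    have hne := atTop_inf_principal_neBot hinf
    have hl0 : l = 0 := by
      refine tendsto_nhds_unique (l := atTop ⊓ 𝓟 (Set.range f)ᶜ) (hl.mono_left inf_le_left)
        (tendsto_const_nhds.congr' ?_)
      filter_upwards [mem_inf_of_right (mem_principal_self _)] with n hn
      exact (hT0 e n hn).symm
    subst hl0
    have hzero : ∀ k, (T e : ℕ → ℝ) (f (Nat.pair k 0)) = 0 := by
      intro k
      have hinj : Function.Injective fun j => f (Nat.pair k j) := fun i j hij =>
        (Nat.pair_eq_pair.1 (hf hij)).2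
      have hlim := hl.comp hinj.nat_tendsto_atTop
      exact tendsto_nhds_unique (tendsto_const_nhds.congr fun j => (hT e k j).symm) hlim
    change T e = 0
    ext n
    change (T e : ℕ → ℝ) n = 0
    by_cases hn : n ∈ Set.range f
    · obtain ⟨m, rfl⟩ := hn
      rw [← Nat.pair_unpair m, hT, hzero]
    · exact hT0 e n hn
  · rintro _ rfl
    exact ⟨Submodule.zero_mem _, 0, tendsto_const_nhds⟩
end
end

section
/- Let D be a separable linear subspace of ℓ^∞ with D ∩ c = {0}, and let E be a separable real Banach space. Then there exists a linear subspace Z of ℓ^∞ such that D ⊆ Z, Z contains a linear subspace isometrically isomorphic to E, and Z ∩ c = {0}. -/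
open Filter Topology

noncomputable section

/-- A separable set of bounded sequences has a common subsequence along which all its members
are Cauchy. -/
theorem exists_strictMono_forall_cauchySeq {S : Set Linfty}
    (hS : TopologicalSpace.IsSeparable S) :
    ∃ φ : ℕ → ℕ, StrictMono φ ∧ ∀ d ∈ S, CauchySeq fun m => (d : ℕ → ℝ) (φ m) := by
  rcases S.eq_empty_or_nonempty with rfl | hne
  · exact ⟨id, strictMono_id, by simp⟩
  obtain ⟨C, hC, hSC⟩ := hS
  have hCne : C.Nonempty := closure_nonempty_iff.mp (hne.mono hSC)
  obtain ⟨u, rfl⟩ := hC.exists_eq_range hCne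
  have hK : IsCompact (Set.univ.pi fun k => Metric.closedBall (0 : ℝ) ‖u k‖) :=
    isCompact_univ_pi fun k => isCompact_closedBall _ _
  obtain ⟨a, -, φ, hφ, ha⟩ := hK.tendsto_subseq (x := fun n k => (u k : ℕ → ℝ) n)
    fun n k _ => by simpa using lp.norm_apply_le_norm ENNReal.top_ne_zero (u k) n
  refine ⟨φ, hφ, fun d hd => Metric.cauchySeq_iff'.mpr fun ε hε => ?_⟩
  obtain ⟨_, ⟨k, rfl⟩, hk⟩ := Metric.mem_closure_iff.mp (hSC hd) (ε / 3) (by positivity)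
  have hcauchy : CauchySeq fun m => (u k : ℕ → ℝ) (φ m) :=
    (tendsto_pi_nhds.mp ha k).cauchySeq
  obtain ⟨N, hN⟩ := Metric.cauchySeq_iff'.mp hcauchy (ε / 3) (by positivity)
  refine ⟨N, fun n hn => ?_⟩
  have hclose (m : ℕ) : |(d : ℕ → ℝ) m - (u k : ℕ → ℝ) m| < ε / 3 := by
    rw [dist_eq_norm] at hk
    simpa using (lp.norm_apply_le_norm ENNReal.top_ne_zero (d - u k) m).trans_lt hk
  have hn' := hN n hn
  rw [Real.dist_eq] at hn' ⊢
  have h₁ := abs_lt.mp (hclose (φ n))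
  have h₂ := abs_lt.mp (hclose (φ N))
  have h₃ := abs_lt.mp hn'
  exact abs_lt.mpr ⟨by linarith, by linarith⟩

/-- A sequence of functionals of norm at most one, norming on a dense set, induces a linear
isometry into `ℓ^∞`. -/
theorem exists_linearIsometry_of_norming_s7 {E : Type*} [NormedAddCommGroup E] [NormedSpace ℝ E]
    (h : ℕ → StrongDual ℝ E) (hh : ∀ n, ‖h n‖ ≤ 1) {S : Set E} (hS : Dense S)
    (hnorm : ∀ e ∈ S, ∃ n, h n e = ‖e‖) :
    ∃ J : E →ₗᵢ[ℝ] Linfty, ∀ e n, (J e : ℕ → ℝ) n = h n e := by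
  have hle (e : E) (n : ℕ) : ‖h n e‖ ≤ ‖e‖ := by
    simpa using (h n).le_of_opNorm_le (hh n) e
  let L : E →ₗ[ℝ] Linfty :=
    { toFun := fun e => ⟨fun n => h n e, memℓp_infty ⟨‖e‖, by rintro _ ⟨n, rfl⟩; exact hle e n⟩⟩
      map_add' := fun x y => by ext n; exact map_add (h n) x y
      map_smul' := fun r x => by ext n; simp }
  have hL (e : E) : ‖L e‖ ≤ ‖e‖ := lp.norm_le_of_forall_le (norm_nonneg e) (hle e)
  have hcont : Continuous L :=
    (L.mkContinuous 1 fun e => by simpa using hL e).continuous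
  have hge (e : E) : ‖e‖ ≤ ‖L e‖ := by
    have hclosed : IsClosed {e : E | ‖e‖ ≤ ‖L e‖} := isClosed_le continuous_norm hcont.norm
    refine hclosed.closure_subset_iff.mpr (fun x hx => ?_) (hS e)
    obtain ⟨n, hn⟩ := hnorm x hx
    have := lp.norm_apply_le_norm ENNReal.top_ne_zero (L x) n
    change ‖h n x‖ ≤ _ at this
    rwa [hn, norm_norm] at this
  exact ⟨⟨L, fun e => (hL e).antisymm (hge e)⟩, fun _ _ => rfl⟩

/-- A separable normed space embeds isometrically in `ℓ^∞` so that the image of no nonzero vector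
converges along a prescribed subsequence. -/
theorem exists_linearIsometry_not_tendsto_subseq (E : Type*) [NormedAddCommGroup E]
    [NormedSpace ℝ E] [TopologicalSpace.SeparableSpace E] {φ : ℕ → ℕ} (hφ : StrictMono φ) :
    ∃ J : E →ₗᵢ[ℝ] Linfty, ∀ e (l : ℝ),
      Tendsto (fun m => (J e : ℕ → ℝ) (φ m)) atTop (𝓝 l) → e = 0 := by
  let u := TopologicalSpace.denseSeq E
  choose f hf hfu using fun k => exists_dual_vector'' ℝ (u k)
  let g : ℕ → StrongDual ℝ E := fun k => Nat.casesOn k 0 f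
  have hg (k : ℕ) : ‖g k‖ ≤ 1 := by
    cases k with
    | zero => simp [g]
    | succ k => exact hf k
  let h : ℕ → StrongDual ℝ E := Function.extend φ (fun m => g m.unpair.1) 0
  have hφh (m : ℕ) : h (φ m) = g m.unpair.1 := hφ.injective.extend_apply _ _ m
  have hh (n : ℕ) : ‖h n‖ ≤ 1 := by
    by_cases hn : ∃ m, φ m = n
    · obtain ⟨m, rfl⟩ := hn
      rw [hφh]
      exact hg _
    · simp [h, Function.extend_apply' _ _ _ hn]
  obtain ⟨J, hJ⟩ := exists_linearIsometry_of_norming_s7 h hh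
    (TopologicalSpace.denseRange_denseSeq E) (by
      rintro _ ⟨k, rfl⟩
      exact ⟨φ (Nat.pair (k + 1) 0), by rw [hφh, Nat.unpair_pair]; exact hfu k⟩)
  refine ⟨J, fun e l hl => ?_⟩
  have hval (k : ℕ) : g k e = l := by
    have hpair : Tendsto (fun j => Nat.pair k j) atTop atTop :=
      tendsto_atTop_mono (fun j => Nat.right_le_pair k j) tendsto_id
    have := hl.comp hpair
    simp only [Function.comp_def, hJ, hφh, Nat.unpair_pair] at this
    exact tendsto_nhds_unique tendsto_const_nhds this
  have hzero (n : ℕ) : h n e = 0 := by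
    by_cases hn : ∃ m, φ m = n
    · obtain ⟨m, rfl⟩ := hn
      rw [hφh, hval, ← hval 0]
      rfl
    · simp [h, Function.extend_apply' _ _ _ hn]
  have hJe : J e = 0 := by
    ext n
    simpa using (hJ e n).trans (hzero n)
  exact (map_eq_zero_iff J J.injective).mp hJe

/-- Given a separable subspace `D ⊆ ℓ^∞` with `D ∩ c = {0}` and a separable Banach
space `E`, there is a subspace `Z` with `D ⊆ Z`, containing an isometric copy of `E`,
and `Z ∩ c = {0}`. -/
theorem stmt7 (D : Submodule ℝ Linfty)
    (hDsep : TopologicalSpace.IsSeparable (D : Set Linfty))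
    (hDc : (D : Set Linfty) ∩ convSeq = {0})
    (E : Type*) [NormedAddCommGroup E] [NormedSpace ℝ E] [CompleteSpace E]
    [TopologicalSpace.SeparableSpace E] :
    ∃ Z : Submodule ℝ Linfty, D ≤ Z ∧
      (∃ F : Submodule ℝ Linfty, F ≤ Z ∧ Nonempty (E ≃ₗᵢ[ℝ] F)) ∧
      (Z : Set Linfty) ∩ convSeq = {0} := by
  obtain ⟨φ, hφ, hD⟩ := exists_strictMono_forall_cauchySeq hDsep
  obtain ⟨J, hJ⟩ := exists_linearIsometry_not_tendsto_subseq E hφ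
  refine ⟨D ⊔ J.toLinearMap.range, le_sup_left,
    ⟨J.toLinearMap.range, le_sup_right, ⟨J.equivRange⟩⟩, ?_⟩
  refine Set.Subset.antisymm ?_ ?_
  · rintro z ⟨hz, l, hl⟩
    obtain ⟨d, hd, _, ⟨e, rfl⟩, rfl⟩ := Submodule.mem_sup.mp hz
    obtain ⟨a, ha⟩ := cauchySeq_tendsto_of_complete (hD d hd)
    have he : e = 0 := hJ e (l - a) <| by
      simpa using (hl.comp hφ.tendsto_atTop).sub ha
    subst he
    rw [← hDc]
    exact ⟨by simpa using hd, l, hl⟩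
  · rintro _ rfl
    have h0 : (0 : Linfty) ∈ (D : Set Linfty) ∩ convSeq := hDc ▸ rfl
    exact ⟨Submodule.zero_mem _, h0.2⟩
end
end

section
/- Let D be a linear subspace of ℓ^∞ admitting a countable Hamel (algebraic) basis. Then there exists a strictly increasing sequence (n_j)_{j∈ℕ} of natural numbers such that for every d ∈ D the sequence of coordinates (d_{n_j})_{j∈ℕ} converges in ℝ. -/
open Filter Topology

noncomputable section

/-- For a subspace `D ⊆ ℓ^∞` with a countable Hamel basis there is a strictly increasing
sequence of indices along which the coordinates of every `d ∈ D` converge. -/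
theorem stmt10 (D : Submodule ℝ Linfty)
    (hDbasis : ∃ B : Set Linfty, B.Countable ∧
      LinearIndependent ℝ ((↑) : B → Linfty) ∧ Submodule.span ℝ B = D) :
    ∃ n : ℕ → ℕ, StrictMono n ∧
      ∀ d ∈ D, ∃ l : ℝ, Tendsto (fun j => (d : ℕ → ℝ) (n j)) atTop (𝓝 l) := by
  obtain ⟨B, hB, -, rfl⟩ := hDbasis
  have : Countable B := hB.to_subtype
  obtain ⟨a, -, n, hn, ha⟩ :=
    (isCompact_univ_pi fun b : B => isCompact_closedBall (0 : ℝ) ‖(b : Linfty)‖).tendsto_subseq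
      (x := fun k (b : B) => (b : Linfty) k) fun k b _ => by
        simpa using lp.norm_apply_le_norm ENNReal.top_ne_zero (b : Linfty) k
  refine ⟨n, hn, fun d hd => ?_⟩
  induction hd using Submodule.span_induction with
  | mem x hx => exact ⟨a ⟨x, hx⟩, tendsto_pi_nhds.1 ha ⟨x, hx⟩⟩
  | zero => exact ⟨0, tendsto_const_nhds⟩
  | add x y _ _ hx hy =>
    obtain ⟨l, hl⟩ := hx
    obtain ⟨m, hm⟩ := hy
    exact ⟨l + m, hl.add hm⟩
  | smul c x _ hx =>
    obtain ⟨l, hl⟩ := hx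
    exact ⟨c * l, hl.const_mul c⟩
end
end

section
/- Let D be a separable linear subspace of ℓ^∞ (in the supremum-norm topology). Then there exists a strictly increasing sequence (n_j)_{j∈ℕ} of natural numbers such that for every d ∈ D the sequence of coordinates (d_{n_j})_{j∈ℕ} converges in ℝ. -/
open Filter Topology

noncomputable section

/-- A countable subset of `ℓ^∞` admits a common subsequence of indices along which all of its
elements converge. -/
theorem exists_strictMono_forall_tendsto_of_countable {c : Set Linfty} (hc : c.Countable) :
    ∃ n : ℕ → ℕ, StrictMono n ∧
      ∀ d ∈ c, ∃ l : ℝ, Tendsto (fun j => (d : ℕ → ℝ) (n j)) atTop (𝓝 l) := by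
  have : Countable c := hc.to_subtype
  have hK : IsCompact (Set.univ.pi fun d : c => Metric.closedBall (0 : ℝ) ‖(d : Linfty)‖) :=
    isCompact_univ_pi fun d => isCompact_closedBall _ _
  obtain ⟨a, -, n, hn, ha⟩ := hK.isSeqCompact
    (x := fun k (d : c) => ((d : Linfty) : ℕ → ℝ) k) fun k d _ => by
      simpa using lp.norm_apply_le_norm ENNReal.top_ne_zero (d : Linfty) k
  exact ⟨n, hn, fun d hd => ⟨a ⟨d, hd⟩, tendsto_pi_nhds.1 ha ⟨d, hd⟩⟩⟩

/-- Convergence along a fixed sequence of indices passes to limits in `ℓ^∞`. -/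
theorem exists_tendsto_of_mem_closure {c : Set Linfty} {n : ℕ → ℕ}
    (hc : ∀ d ∈ c, ∃ l : ℝ, Tendsto (fun j => (d : ℕ → ℝ) (n j)) atTop (𝓝 l))
    {d : Linfty} (hd : d ∈ closure c) :
    ∃ l : ℝ, Tendsto (fun j => (d : ℕ → ℝ) (n j)) atTop (𝓝 l) := by
  refine cauchySeq_tendsto_of_complete (Metric.cauchySeq_iff.2 fun ε hε => ?_)
  obtain ⟨e, he, hde⟩ := Metric.mem_closure_iff.1 hd (ε / 3) (by positivity)
  obtain ⟨l, hl⟩ := hc e he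
  obtain ⟨N, hN⟩ := Metric.cauchySeq_iff.1 hl.cauchySeq (ε / 3) (by positivity)
  have hcoord (k : ℕ) : dist ((d : ℕ → ℝ) k) ((e : ℕ → ℝ) k) < ε / 3 := by
    rw [dist_eq_norm] at hde ⊢
    exact (lp.norm_apply_le_norm ENNReal.top_ne_zero (d - e) k).trans_lt hde
  refine ⟨N, fun i hi j hj => ?_⟩
  have h := dist_triangle4 ((d : ℕ → ℝ) (n i)) ((e : ℕ → ℝ) (n i)) ((e : ℕ → ℝ) (n j))
    ((d : ℕ → ℝ) (n j))
  have hj' := hcoord (n j)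
  rw [dist_comm] at hj'
  linarith [hcoord (n i), hN i hi j hj]

/-- For a separable subspace `D ⊆ ℓ^∞` there is a strictly increasing sequence of
indices along which the coordinates of every `d ∈ D` converge. -/
theorem stmt11 (D : Submodule ℝ Linfty)
    (hDsep : TopologicalSpace.IsSeparable (D : Set Linfty)) :
    ∃ n : ℕ → ℕ, StrictMono n ∧
      ∀ d ∈ D, ∃ l : ℝ, Tendsto (fun j => (d : ℕ → ℝ) (n j)) atTop (𝓝 l) := by
  obtain ⟨c, hc, hDc⟩ := hDsep
  obtain ⟨n, hn, hconv⟩ := exists_strictMono_forall_tendsto_of_countable hc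
  exact ⟨n, hn, fun d hd => exists_tendsto_of_mem_closure hconv (hDc hd)⟩
end
end
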